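/- Let U be a ternary unitary four-site gate, L even with L ≥ 4t, t ≥ 1, and x, y lattice sites with representative ŷ ∈ {0,…,L−1}² of y. Say the light-ray condition holds if for each k ∈ {1,2}: x_k = ŷ_k + 2t in ZMod L when ŷ_k is odd, and x_k = ŷ_k − 2t in ZMod L when ŷ_k is even. If the light-ray condition fails, then for all traceless a, b : Matrix (Fin d) (Fin d) ℂ, d^{−L²} · Tr(a_x * 𝕌^{−t} * b_y * 𝕌^t) = 0. -/

import Mathlib

open Matrix

/-- A matrix is unitary if it is inverted by its conjugate transpose on both sides. -/
def IsUnitary {n : Type*} [Fintype n] [DecidableEq n] (M : Matrix n n ℂ) : Prop :=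
  M * Mᴴ = 1 ∧ Mᴴ * M = 1

/-- Index type of a four-site gate, legs ordered by the plaquette sites
`(0,0), (1,0), (0,1), (1,1)`. -/
abbrev FourIdx (d : ℕ) := Fin d × Fin d × Fin d × Fin d

/-- Lattice sites of the `L × L` torus. -/
abbrev Site (L : ℕ) := ZMod L × ZMod L

/-- Index type of global operators: one `Fin d` leg per lattice site. -/
abbrev GlobalIdx (d L : ℕ) := Site L → Fin d

/-- The global operator `U_{p(x)}`, acting as the four-site gate `U` on the legs at the
plaquette sites `x, x+(1,0), x+(0,1), x+(1,1)` (in this order) and as the identity elsewhere. -/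
noncomputable def plaqOp {d L : ℕ} [NeZero L] (U : Matrix (FourIdx d) (FourIdx d) ℂ)
    (x : Site L) : Matrix (GlobalIdx d L) (GlobalIdx d L) ℂ :=
  Matrix.of fun f g =>
    if ∀ u : Site L, u ≠ x → u ≠ x + (1, 0) → u ≠ x + (0, 1) → u ≠ x + (1, 1) → f u = g u then
      U (f x, f (x + (1, 0)), f (x + (0, 1)), f (x + (1, 1)))
        (g x, g (x + (1, 0)), g (x + (0, 1)), g (x + (1, 1)))
    else 0

/-- The even layer `𝕌_ee`: product of the mutually commuting gates `U_{p(2i,2j)}`. -/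
noncomputable def Uee (d L : ℕ) [NeZero L] (U : Matrix (FourIdx d) (FourIdx d) ℂ) :
    Matrix (GlobalIdx d L) (GlobalIdx d L) ℂ :=
  (((List.range (L / 2)).flatMap fun i => (List.range (L / 2)).map fun j =>
      plaqOp U (((2 * i : ℕ) : ZMod L), ((2 * j : ℕ) : ZMod L)))).prod

/-- The odd layer `𝕌_oo`: product of the mutually commuting gates `U_{p(2i+1,2j+1)}`. -/
noncomputable def Uoo (d L : ℕ) [NeZero L] (U : Matrix (FourIdx d) (FourIdx d) ℂ) :
    Matrix (GlobalIdx d L) (GlobalIdx d L) ℂ :=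
  (((List.range (L / 2)).flatMap fun i => (List.range (L / 2)).map fun j =>
      plaqOp U (((2 * i + 1 : ℕ) : ZMod L), ((2 * j + 1 : ℕ) : ZMod L)))).prod

/-- One discrete time step `𝕌 = 𝕌_oo ⬝ 𝕌_ee`. -/
noncomputable def Ustep (d L : ℕ) [NeZero L] (U : Matrix (FourIdx d) (FourIdx d) ℂ) :
    Matrix (GlobalIdx d L) (GlobalIdx d L) ℂ :=
  Uoo d L U * Uee d L U

/-- The global operator acting as the `d × d` matrix `a` on leg `x` and as the identity
elsewhere. -/
noncomputable def siteOpG {d L : ℕ} [NeZero L] (a : Matrix (Fin d) (Fin d) ℂ) (x : Site L) :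
    Matrix (GlobalIdx d L) (GlobalIdx d L) ℂ :=
  Matrix.of fun f g =>
    (if ∀ u : Site L, u ≠ x → f u = g u then 1 else 0) * a (f x) (g x)

/-- Circular distance in `ZMod L`. -/
def cdist {L : ℕ} [NeZero L] (a b : ZMod L) : ℕ := min (a - b).val (b - a).val

/-- Torus ℓ∞-distance of two lattice sites. -/
def torusDist {L : ℕ} [NeZero L] (u v : Site L) : ℕ :=
  max (cdist u.1 v.1) (cdist u.2 v.2)

/-- The anchor site `m` of the plaquette containing `y`: with `ŷ ∈ {0,…,L−1}²` the
representative of `y`, `m_k = ŷ_k` if `ŷ_k` is odd and `m_k = ŷ_k − 1` if `ŷ_k` is even. -/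
def msite {L : ℕ} [NeZero L] (y : Site L) : Site L :=
  ((if Odd y.1.val then y.1 else y.1 - 1), (if Odd y.2.val then y.2 else y.2 - 1))

/-- The base of the light cone of `y` for time `t`: all sites within torus ℓ∞-distance
`2t − 1` of some site of the plaquette anchored at `msite y`. -/
def LCfin {L : ℕ} [NeZero L] (y : Site L) (t : ℕ) : Finset (Site L) :=
  Finset.univ.filter fun z =>
    ∃ w ∈ ({msite y, msite y + (1, 0), msite y + (0, 1), msite y + (1, 1)} : Finset (Site L)),
      torusDist w z ≤ 2 * t - 1

/-- The x₁-reshuffle of a four-site gate. -/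
def reshuffle1 {d : ℕ} (U : Matrix (FourIdx d) (FourIdx d) ℂ) :
    Matrix (FourIdx d) (FourIdx d) ℂ :=
  Matrix.of fun r c => U (c.1, r.1, c.2.1, r.2.1) (c.2.2.1, r.2.2.1, c.2.2.2, r.2.2.2)

/-- The x₂-reshuffle of a four-site gate. -/
def reshuffle2 {d : ℕ} (U : Matrix (FourIdx d) (FourIdx d) ℂ) :
    Matrix (FourIdx d) (FourIdx d) ℂ :=
  Matrix.of fun r c => U (c.1, c.2.1, r.1, r.2.1) (c.2.2.1, c.2.2.2, r.2.2.1, r.2.2.2)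

/-- A four-site gate is ternary unitary if it and both of its spatial reshuffles are unitary. -/
def TernaryUnitary {d : ℕ} (U : Matrix (FourIdx d) (FourIdx d) ℂ) : Prop :=
  IsUnitary U ∧ IsUnitary (reshuffle1 U) ∧ IsUnitary (reshuffle2 U)

/-- The light-ray condition: in each coordinate `k`, `x_k = ŷ_k + 2t` (mod `L`) when the
representative `ŷ_k` is odd and `x_k = ŷ_k − 2t` (mod `L`) when `ŷ_k` is even. -/
def LightRay {L : ℕ} [NeZero L] (x y : Site L) (t : ℕ) : Prop :=
  (if Odd y.1.val then x.1 = y.1 + ((2 * t : ℕ) : ZMod L)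
    else x.1 = y.1 - ((2 * t : ℕ) : ZMod L)) ∧
  (if Odd y.2.val then x.2 = y.2 + ((2 * t : ℕ) : ZMod L)
    else x.2 = y.2 - ((2 * t : ℕ) : ZMod L))

set_option linter.unusedSectionVars false
set_option linter.unusedSimpArgs false

section TUHelpers

variable {S β : Type} [Fintype S] [DecidableEq S] [Fintype β] [DecidableEq β]

/-- `X` acts trivially on the leg `u`. -/
def TrivAt (X : Matrix (S → β) (S → β) ℂ) (u : S) : Prop :=
  (∀ f g, f u ≠ g u → X f g = 0) ∧
    ∀ f g c, f u = g u → X (Function.update f u c) (Function.update g u c) = X f g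

/-- `W` is orthogonal to all operators acting trivially on `C`. -/
def NullOn (W : Matrix (S → β) (S → β) ℂ) (C : Set S) : Prop :=
  ∀ X : Matrix (S → β) (S → β) ℂ, (∀ u ∈ C, TrivAt X u) → (X * W).trace = 0

theorem TrivAt.conjTranspose {X : Matrix (S → β) (S → β) ℂ} {u : S} (h : TrivAt X u) :
    TrivAt Xᴴ u := by
  refine ⟨fun f g hfg => ?_, fun f g c hfg => ?_⟩
  · simp [h.1 g f (Ne.symm hfg)]
  · simp [h.2 g f c hfg.symm]

theorem TrivAt.mul {X Y : Matrix (S → β) (S → β) ℂ} {u : S} (hX : TrivAt X u)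
    (hY : TrivAt Y u) : TrivAt (X * Y) u := by
  refine ⟨fun f g hfg => ?_, fun f g c hfg => ?_⟩
  · rw [Matrix.mul_apply]
    refine Finset.sum_eq_zero fun h _ => ?_
    by_cases h1 : f u = h u
    · rw [hY.1 h g (h1 ▸ hfg), mul_zero]
    · rw [hX.1 f h h1, zero_mul]
  · rw [Matrix.mul_apply, Matrix.mul_apply]
    let σ : (S → β) → (S → β) := fun h => Function.update h u (Equiv.swap (f u) c (h u))
    have hσ : Function.Involutive σ := by
      intro h
      simp [σ]
    refine (Fintype.sum_equiv hσ.toPerm _ _ fun h => ?_).symm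
    change _ = X _ (σ h) * Y (σ h) _
    by_cases h1 : f u = h u
    · have : σ h = Function.update h u c := by simp [σ, ← h1]
      rw [this, hX.2 f h c h1, hY.2 h g c (h1 ▸ hfg)]
    · rw [hX.1 f h h1, hX.1 _ (σ h), zero_mul, zero_mul]
      simp only [σ, Function.update_self]
      intro h2
      apply h1
      rw [eq_comm, Equiv.swap_apply_eq_iff] at h2
      simpa using h2.symm

/-- Partial trace over leg `u`, tensored with the identity. -/
noncomputable def ptr (u : S) (X : Matrix (S → β) (S → β) ℂ) : Matrix (S → β) (S → β) ℂ :=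
  Matrix.of fun f g =>
    if f u = g u then ∑ a, X (Function.update f u a) (Function.update g u a) else 0

theorem ptr_self (u : S) (X : Matrix (S → β) (S → β) ℂ) : TrivAt (ptr u X) u := by
  refine ⟨fun f g hfg => ?_, fun f g c hfg => ?_⟩
  · simp [ptr, hfg]
  · simp [ptr, hfg]

theorem ptr_other {u v : S} {X : Matrix (S → β) (S → β) ℂ} (h : TrivAt X v) :
    TrivAt (ptr u X) v := by
  by_cases huv : v = u
  · subst huv; exact ptr_self _ _
  refine ⟨fun f g hfg => ?_, fun f g c hfg => ?_⟩
  · simp only [ptr, of_apply]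
    split_ifs with h1
    · refine Finset.sum_eq_zero fun a _ => h.1 _ _ ?_
      simpa [Function.update_of_ne huv] using hfg
    · rfl
  · simp only [ptr, of_apply, Function.update_of_ne (Ne.symm huv)]
    split_ifs with h1
    · refine Finset.sum_congr rfl fun a _ => ?_
      rw [Function.update_comm huv, Function.update_comm huv, h.2]
      simpa [Function.update_of_ne huv] using hfg
    · rfl

/-- Four distinct legs. -/
structure Quad (S : Type) where
  l1 : S
  l2 : S
  r1 : S
  r2 : S
  h12 : l1 ≠ l2
  h13 : l1 ≠ r1
  h14 : l1 ≠ r2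
  h23 : l2 ≠ r1
  h24 : l2 ≠ r2
  h34 : r1 ≠ r2

/-- Membership in a quadruple of legs. -/
def Quad.On (q : Quad S) (u : S) : Prop := u = q.l1 ∨ u = q.l2 ∨ u = q.r1 ∨ u = q.r2

instance (q : Quad S) (u : S) : Decidable (q.On u) := by unfold Quad.On; infer_instance

/-- Splitting of the legs into left, right and remaining ones. -/
def Quad.equiv (q : Quad S) :
    (S → β) ≃ (β × β) × (β × β) × ({u // ¬ q.On u} → β) where
  toFun f := ((f q.l1, f q.l2), (f q.r1, f q.r2), fun u => f u)
  invFun p u := if h : q.On u then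
      (if u = q.l1 then p.1.1 else if u = q.l2 then p.1.2 else
        if u = q.r1 then p.2.1.1 else p.2.1.2)
    else p.2.2 ⟨u, h⟩
  left_inv f := by
    funext u
    by_cases h : q.On u
    · simp only [h, dif_pos]
      split_ifs with h1 h2 h3
      · rw [h1]
      · rw [h2]
      · rw [h3]
      · obtain h | h | h | h := h
        · exact absurd h h1
        · exact absurd h h2
        · exact absurd h h3
        · rw [h]
    · simp [h]
  right_inv p := by
    obtain ⟨⟨a1, a2⟩, ⟨b1, b2⟩, r⟩ := p
    have e1 : q.On q.l1 := Or.inl rfl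
    have e2 : q.On q.l2 := Or.inr (Or.inl rfl)
    have e3 : q.On q.r1 := Or.inr (Or.inr (Or.inl rfl))
    have e4 : q.On q.r2 := Or.inr (Or.inr (Or.inr rfl))
    simp only [e1, e2, e3, e4, dif_pos, if_true, q.h12.symm, q.h13.symm, q.h14.symm, q.h23.symm,
      q.h24.symm, q.h34.symm, if_false, Prod.mk.injEq, true_and]
    funext u
    simp [u.2]

/-- The configuration with given components. -/
def Quad.mk' (q : Quad S) (a b : β × β) (r : {u // ¬ q.On u} → β) : S → β :=
  q.equiv.symm (a, b, r)

section
variable (q : Quad S) (a b : β × β) (r : {u // ¬ q.On u} → β)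

theorem Quad.mk'_l1 : q.mk' a b r q.l1 = a.1 :=
  congrArg (fun p => p.1.1) (q.equiv.apply_symm_apply (a, b, r))
theorem Quad.mk'_l2 : q.mk' a b r q.l2 = a.2 :=
  congrArg (fun p => p.1.2) (q.equiv.apply_symm_apply (a, b, r))
theorem Quad.mk'_r1 : q.mk' a b r q.r1 = b.1 :=
  congrArg (fun p => p.2.1.1) (q.equiv.apply_symm_apply (a, b, r))
theorem Quad.mk'_r2 : q.mk' a b r q.r2 = b.2 :=
  congrArg (fun p => p.2.1.2) (q.equiv.apply_symm_apply (a, b, r))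
theorem Quad.mk'_off (u : {u // ¬ q.On u}) : q.mk' a b r u = r u :=
  congrFun (congrArg (fun p => p.2.2) (q.equiv.apply_symm_apply (a, b, r))) u

theorem Quad.ext' {f g : S → β} (h1 : f q.l1 = g q.l1) (h2 : f q.l2 = g q.l2)
    (h3 : f q.r1 = g q.r1) (h4 : f q.r2 = g q.r2) (h : ∀ u, ¬ q.On u → f u = g u) : f = g := by
  funext u
  by_cases hu : q.On u
  · obtain rfl | rfl | rfl | rfl := hu <;> assumption
  · exact h u hu

theorem Quad.on1 : q.On q.l1 := Or.inl rfl
theorem Quad.on2 : q.On q.l2 := Or.inr (Or.inl rfl)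
theorem Quad.on3 : q.On q.r1 := Or.inr (Or.inr (Or.inl rfl))
theorem Quad.on4 : q.On q.r2 := Or.inr (Or.inr (Or.inr rfl))

theorem Quad.upd_l1 (c : β) : Function.update (q.mk' a b r) q.l1 c = q.mk' (c, a.2) b r := by
  apply q.ext'
  · simp [q.mk'_l1]
  · simp [q.mk'_l2, Function.update_of_ne q.h12.symm]
  · simp [q.mk'_r1, Function.update_of_ne q.h13.symm]
  · simp [q.mk'_r2, Function.update_of_ne q.h14.symm]
  · intro u hu
    rw [Function.update_of_ne (a' := q.l1) (fun h => hu (by rw [h]; exact q.on1)), q.mk'_off a b r ⟨u, hu⟩,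
      q.mk'_off _ b r ⟨u, hu⟩]

theorem Quad.upd_l2 (c : β) : Function.update (q.mk' a b r) q.l2 c = q.mk' (a.1, c) b r := by
  apply q.ext'
  · simp [q.mk'_l1, Function.update_of_ne q.h12]
  · simp [q.mk'_l2]
  · simp [q.mk'_r1, Function.update_of_ne q.h23.symm]
  · simp [q.mk'_r2, Function.update_of_ne q.h24.symm]
  · intro u hu
    rw [Function.update_of_ne (a' := q.l2) (fun h => hu (by rw [h]; exact q.on2)), q.mk'_off a b r ⟨u, hu⟩,
      q.mk'_off _ b r ⟨u, hu⟩]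

theorem Quad.upd_r1 (c : β) : Function.update (q.mk' a b r) q.r1 c = q.mk' a (c, b.2) r := by
  apply q.ext'
  · simp [q.mk'_l1, Function.update_of_ne q.h13]
  · simp [q.mk'_l2, Function.update_of_ne q.h23]
  · simp [q.mk'_r1]
  · simp [q.mk'_r2, Function.update_of_ne q.h34.symm]
  · intro u hu
    rw [Function.update_of_ne (a' := q.r1) (fun h => hu (by rw [h]; exact q.on3)), q.mk'_off a b r ⟨u, hu⟩,
      q.mk'_off _ _ r ⟨u, hu⟩]

theorem Quad.upd_r2 (c : β) : Function.update (q.mk' a b r) q.r2 c = q.mk' a (b.1, c) r := by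
  apply q.ext'
  · simp [q.mk'_l1, Function.update_of_ne q.h14]
  · simp [q.mk'_l2, Function.update_of_ne q.h24]
  · simp [q.mk'_r1, Function.update_of_ne q.h34]
  · simp [q.mk'_r2]
  · intro u hu
    rw [Function.update_of_ne (a' := q.r2) (fun h => hu (by rw [h]; exact q.on4)), q.mk'_off a b r ⟨u, hu⟩,
      q.mk'_off _ _ r ⟨u, hu⟩]
end

theorem Quad.sum_eq (q : Quad S) (F : (S → β) → ℂ) :
    ∑ f, F f = ∑ a, ∑ b, ∑ r, F (q.mk' a b r) := by
  rw [← Equiv.sum_comp q.equiv.symm]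
  simp only [Fintype.sum_prod_type]
  rfl

/-- Block form of an operator acting trivially on the right legs. -/
theorem TrivAt.right {X : Matrix (S → β) (S → β) ℂ} {q : Quad S} (h1 : TrivAt X q.r1)
    (h2 : TrivAt X q.r2) (b0 a b r a' b' r') :
    X (q.mk' a b r) (q.mk' a' b' r') =
      if b = b' then X (q.mk' a b0 r) (q.mk' a' b0 r') else 0 := by
  split_ifs with h
  · subst h
    rw [← h1.2 _ _ b0.1 (by simp [q.mk'_r1]), q.upd_r1, q.upd_r1,
      ← h2.2 _ _ b0.2 (by simp [q.mk'_r2]), q.upd_r2, q.upd_r2]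
  · by_cases hb : b.1 = b'.1
    · apply h2.1
      rw [q.mk'_r2, q.mk'_r2]
      exact fun h' => h (Prod.ext hb h')
    · apply h1.1
      rwa [q.mk'_r1, q.mk'_r1]

theorem TrivAt.left {X : Matrix (S → β) (S → β) ℂ} {q : Quad S} (h1 : TrivAt X q.l1)
    (h2 : TrivAt X q.l2) (a0 a b r a' b' r') :
    X (q.mk' a b r) (q.mk' a' b' r') =
      if a = a' then X (q.mk' a0 b r) (q.mk' a0 b' r') else 0 := by
  split_ifs with h
  · subst h
    rw [← h1.2 _ _ a0.1 (by simp [q.mk'_l1]), q.upd_l1, q.upd_l1,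
      ← h2.2 _ _ a0.2 (by simp [q.mk'_l2]), q.upd_l2, q.upd_l2]
  · by_cases hb : a.1 = a'.1
    · apply h2.1
      rw [q.mk'_l2, q.mk'_l2]
      exact fun h' => h (Prod.ext hb h')
    · apply h1.1
      rwa [q.mk'_l1, q.mk'_l1]

/-- `V` acts as the gate `G` on the quadruple `q`. -/
def IsGate (q : Quad S) (G : (β × β) → (β × β) → (β × β) → (β × β) → ℂ)
    (V : Matrix (S → β) (S → β) ℂ) : Prop :=
  (∀ f g, (∀ u, ¬ q.On u → f u = g u) →
    V f g = G (f q.l1, f q.l2) (f q.r1, f q.r2) (g q.l1, g q.l2) (g q.r1, g q.r2)) ∧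
  (∀ f g, ¬ (∀ u, ¬ q.On u → f u = g u) → V f g = 0)

variable {q : Quad S} {G : (β × β) → (β × β) → (β × β) → (β × β) → ℂ}
  {V : Matrix (S → β) (S → β) ℂ}

theorem IsGate.block (hV : IsGate q G V) (a b r a' b' r') :
    V (q.mk' a b r) (q.mk' a' b' r') = if r = r' then G a b a' b' else 0 := by
  split_ifs with h
  · subst h
    rw [hV.1]
    · simp only [q.mk'_l1, q.mk'_l2, q.mk'_r1, q.mk'_r2]
    · intro u hu
      rw [q.mk'_off a b r ⟨u, hu⟩, q.mk'_off a' b' r ⟨u, hu⟩]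
  · apply hV.2
    intro h'
    apply h
    funext u
    have := h' u u.2
    rwa [q.mk'_off, q.mk'_off] at this

theorem IsGate.triv (hV : IsGate q G V) {u : S} (hu : ¬ q.On u) : TrivAt V u := by
  have e1 : q.l1 ≠ u := fun h => hu (h ▸ q.on1)
  have e2 : q.l2 ≠ u := fun h => hu (h ▸ q.on2)
  have e3 : q.r1 ≠ u := fun h => hu (h ▸ q.on3)
  have e4 : q.r2 ≠ u := fun h => hu (h ▸ q.on4)
  refine ⟨fun f g hfg => hV.2 _ _ fun h => hfg (h u hu), fun f g c hfg => ?_⟩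
  by_cases h : ∀ v, ¬ q.On v → f v = g v
  · rw [hV.1 f g h, hV.1]
    · simp only [Function.update_of_ne e1, Function.update_of_ne e2, Function.update_of_ne e3,
        Function.update_of_ne e4]
    · intro v hv
      by_cases hvu : v = u
      · subst hvu; simp
      · rw [Function.update_of_ne hvu, Function.update_of_ne hvu, h v hv]
  · rw [hV.2 f g h, hV.2]
    intro h'
    apply h
    intro v hv
    by_cases hvu : v = u
    · subst hvu; exact hfg
    · have := h' v hv
      rwa [Function.update_of_ne hvu, Function.update_of_ne hvu] at this

/-- Conjugating an operator trivial on the legs of the gate does nothing. -/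
theorem IsGate.conj_triv (hV : IsGate q G V)
    (hG : ∀ a b a' b', ∑ c, ∑ e, star (G c e a b) * G c e a' b' =
      if a = a' then (if b = b' then 1 else 0) else 0)
    {W : Matrix (S → β) (S → β) ℂ} (hW : ∀ u, q.On u → TrivAt W u) :
    Vᴴ * W * V = W := by
  ext f g
  obtain ⟨⟨a, b, r⟩, rfl⟩ := q.equiv.symm.surjective f
  obtain ⟨⟨a', b', r'⟩, rfl⟩ := q.equiv.symm.surjective g
  change (Vᴴ * W * V) (q.mk' a b r) (q.mk' a' b' r') = W (q.mk' a b r) (q.mk' a' b' r')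
  obtain ⟨W0, key⟩ : ∃ W0 : ({u // ¬ q.On u} → β) → ({u // ¬ q.On u} → β) → ℂ,
      ∀ a1 b1 r1 a2 b2 r2, W (q.mk' a1 b1 r1) (q.mk' a2 b2 r2) =
      if a1 = a2 then (if b1 = b2 then W0 r1 r2 else 0) else 0 := by
    refine ⟨fun r1 r2 => W (q.mk' a b r1) (q.mk' a b r2), fun a1 b1 r1 a2 b2 r2 => ?_⟩
    rw [TrivAt.left (hW _ q.on1) (hW _ q.on2) a, TrivAt.right (hW _ q.on3) (hW _ q.on4) b]
  simp only [Matrix.mul_apply, q.sum_eq, conjTranspose_apply, hV.block, key, Finset.sum_mul]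
  simp only [apply_ite star, star_zero, ite_mul, mul_ite, zero_mul, mul_zero,
    Finset.sum_ite_eq, Finset.sum_ite_eq', Finset.mem_univ, if_true]
  have := hG a b a' b'
  calc _ = ∑ c, ∑ e, (star (G c e a b) * G c e a' b') * W0 r r' := by
        simp only [Finset.sum_ite_irrel, Finset.sum_const_zero, Finset.sum_ite_eq, Finset.sum_ite_eq', Finset.mem_univ, if_true]
        refine Finset.sum_congr rfl fun c _ => Finset.sum_congr rfl fun e _ => ?_
        ring
    _ = _ := by
        simp only [← Finset.sum_mul]
        rw [this]
        split_ifs <;> simp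

/-- The dual-unitarity step. -/
theorem IsGate.dual_partial (hV : IsGate q G V)
    (hG : ∀ a a' c c', ∑ b, ∑ e, G a b c e * star (G a' b c' e) =
      if a = a' then (if c = c' then 1 else 0) else 0)
    {X : Matrix (S → β) (S → β) ℂ}
    {X0 : (β × β) → ({u // ¬ q.On u} → β) → (β × β) → ({u // ¬ q.On u} → β) → ℂ}
    (hX : ∀ a b r a' b' r', X (q.mk' a b r) (q.mk' a' b' r') =
      if b = b' then X0 a r a' r' else 0) (a r a' r') :
    ∑ b, (V * X * Vᴴ) (q.mk' a b r) (q.mk' a' b r') =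
      if a = a' then ∑ c, X0 c r c r' else 0 := by
  simp only [Matrix.mul_apply, q.sum_eq, conjTranspose_apply, hV.block]
  simp only [hX, Finset.sum_mul]
  simp only [apply_ite star, star_zero, ite_mul, mul_ite, zero_mul, mul_zero,
    Finset.sum_ite_eq, Finset.sum_ite_eq', Finset.mem_univ, if_true]
  simp only [Finset.sum_ite_irrel, Finset.sum_const_zero, Finset.sum_ite_eq, Finset.sum_ite_eq', Finset.mem_univ, if_true]
  calc _ = ∑ c', ∑ c, (∑ b, ∑ e, G a b c e * star (G a' b c' e)) *
        X0 c r c' r' := by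
        rw [Finset.sum_comm]
        refine Finset.sum_congr rfl fun c' _ => ?_
        simp only [Finset.sum_mul]
        conv_rhs => rw [Finset.sum_comm]
        refine Finset.sum_congr rfl fun b _ => ?_
        rw [Finset.sum_comm]
        refine Finset.sum_congr rfl fun c _ => Finset.sum_congr rfl fun e _ => ?_
        ring
    _ = _ := by
        simp only [hG]
        split_ifs <;> simp

theorem IsGate.null_move (hV : IsGate q G V) [Nonempty β]
    (hG : ∀ a a' c c', ∑ b, ∑ e, G a b c e * star (G a' b c' e) =
      if a = a' then (if c = c' then 1 else 0) else 0)
    {W : Matrix (S → β) (S → β) ℂ} (h1 : TrivAt W q.r1) (h2 : TrivAt W q.r2)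
    {C C' : Set S} (hW : NullOn W C) (hr1 : q.r1 ∈ C') (hr2 : q.r2 ∈ C')
    (hC : ∀ u ∈ C, u ∈ C' ∨ u = q.l1 ∨ u = q.l2) :
    NullOn (Vᴴ * W * V) C' := by
  intro X hX
  obtain ⟨β0⟩ := ‹Nonempty β›
  set b0 : β × β := (β0, β0)
  have hX1 := hX _ hr1
  have hX2 := hX _ hr2
  obtain ⟨X0, kX⟩ : ∃ X0 : (β × β) → ({u // ¬ q.On u} → β) → (β × β) →
      ({u // ¬ q.On u} → β) → ℂ, ∀ a b r a' b' r', X (q.mk' a b r) (q.mk' a' b' r') =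
      if b = b' then X0 a r a' r' else 0 := ⟨_, TrivAt.right hX1 hX2 b0⟩
  obtain ⟨W0, kW⟩ : ∃ W0 : (β × β) → ({u // ¬ q.On u} → β) → (β × β) →
      ({u // ¬ q.On u} → β) → ℂ, ∀ a b r a' b' r', W (q.mk' a b r) (q.mk' a' b' r') =
      if b = b' then W0 a r a' r' else 0 := ⟨_, TrivAt.right h1 h2 b0⟩
  have h0 := hW (ptr q.l1 (ptr q.l2 X)) (by
    intro u hu
    obtain h | h | h := hC u hu
    · exact ptr_other (ptr_other (hX u h))
    · exact h ▸ ptr_self _ _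
    · exact ptr_other (h ▸ ptr_self _ _))
  have hp : ∀ a b r a' b' r', ptr q.l1 (ptr q.l2 X) (q.mk' a b r) (q.mk' a' b' r') =
      if a = a' then (if b = b' then ∑ c, X0 c r c r' else 0) else 0 := by
    intro a b r a' b' r'
    have ha : (a = a') ↔ a.1 = a'.1 ∧ a.2 = a'.2 := Prod.ext_iff
    simp only [ptr, of_apply, q.upd_l1, q.upd_l2, q.mk'_l1, q.mk'_l2, ha,
      kX, Fintype.sum_prod_type]
    by_cases e1 : a.1 = a'.1 <;> by_cases e2 : a.2 = a'.2 <;> by_cases e3 : b = b' <;>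
      simp [e1, e2, e3]
  have e1 : (X * (Vᴴ * W * V)).trace = ((V * X * Vᴴ) * W).trace := by
    rw [← Matrix.mul_assoc, Matrix.trace_mul_comm]
    simp only [Matrix.mul_assoc]
  rw [e1]
  have tr_eq : ∀ Y : Matrix (S → β) (S → β) ℂ, (Y * W).trace =
      ∑ a, ∑ r, ∑ a', ∑ r', (∑ b, Y (q.mk' a b r) (q.mk' a' b r')) *
        W0 a' r' a r := by
    intro Y
    simp only [Matrix.trace, Matrix.diag, Matrix.mul_apply, q.sum_eq,
      kW]
    simp only [mul_ite, mul_zero, Finset.sum_ite_irrel, Finset.sum_const_zero, Finset.sum_ite_eq,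
      Finset.sum_ite_eq', Finset.mem_univ, if_true]
    refine Finset.sum_congr rfl fun a _ => ?_
    rw [Finset.sum_comm]
    refine Finset.sum_congr rfl fun r _ => ?_
    rw [Finset.sum_comm]
    refine Finset.sum_congr rfl fun a' _ => ?_
    rw [Finset.sum_comm]
    refine Finset.sum_congr rfl fun r' _ => ?_
    rw [Finset.sum_mul]
  rw [tr_eq] at h0 ⊢
  simp only [hV.dual_partial hG kX]
  simp only [hp, if_true, Finset.sum_const, Finset.card_univ, nsmul_eq_mul] at h0
  have hc : ((Fintype.card (β × β) : ℕ) : ℂ) ≠ 0 := by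
    have : Nonempty (β × β) := ⟨b0⟩
    exact_mod_cast Fintype.card_ne_zero
  apply (mul_right_injective₀ hc)
  simp only [mul_zero]
  refine Eq.trans ?_ h0
  simp only [Finset.mul_sum, Finset.sum_mul]
  refine Finset.sum_congr rfl fun a _ => Finset.sum_congr rfl fun r _ =>
    Finset.sum_congr rfl fun a' _ => Finset.sum_congr rfl fun r' _ => ?_
  split_ifs
  · simp only [Finset.mul_sum, Finset.sum_mul, mul_assoc]
  · simp

theorem IsGate.null_stay (hV : IsGate q G V) {W : Matrix (S → β) (S → β) ℂ} {C : Set S}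
    (hW : NullOn W C) (hC : ∀ u ∈ C, ¬ q.On u) : NullOn (Vᴴ * W * V) C := by
  intro X hX
  have e1 : (X * (Vᴴ * W * V)).trace = ((V * X * Vᴴ) * W).trace := by
    rw [← Matrix.mul_assoc, Matrix.trace_mul_comm]
    simp only [Matrix.mul_assoc]
  rw [e1]
  exact hW _ fun u hu => ((hV.triv (hC u hu)).mul (hX u hu)).mul (hV.triv (hC u hu)).conjTranspose

theorem NullOn.mono {W : Matrix (S → β) (S → β) ℂ} {C C' : Set S} (h : NullOn W C)
    (hC : C ⊆ C') : NullOn W C' := fun X hX => h X fun u hu => hX u (hC hu)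

section Layer

variable {ι : Type} {qd : ι → Quad S} {op : ι → Matrix (S → β) (S → β) ℂ}

theorem layer_conj_cons (i : ι) (l : List ι) (W : Matrix (S → β) (S → β) ℂ) :
    (((i :: l).map op).prod)ᴴ * W * ((i :: l).map op).prod =
      ((l.map op).prod)ᴴ * ((op i)ᴴ * W * op i) * (l.map op).prod := by
  simp only [List.map_cons, List.prod_cons, conjTranspose_mul, Matrix.mul_assoc]

theorem layer_cone (hV : ∀ i, IsGate (qd i) G (op i))
    (hG : ∀ a b a' b', ∑ c, ∑ e, star (G c e a b) * G c e a' b' =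
      if a = a' then (if b = b' then 1 else 0) else 0) (l : List ι) :
    ∀ (W : Matrix (S → β) (S → β) ℂ) (T : Set S),
      l.Pairwise (fun i j => ∀ u, (qd i).On u → ¬ (qd j).On u) →
      (∀ u, u ∉ T → TrivAt W u) → ∀ u, u ∉ T →
      (∀ i ∈ l, (qd i).On u → ∀ v, (qd i).On v → v ∉ T) →
      TrivAt (((l.map op).prod)ᴴ * W * (l.map op).prod) u := by
  induction l with
  | nil =>
    intro W T _ hW u hu _
    simpa using hW u hu
  | cons i l ih =>
    intro W T hd hW u hu hl
    rw [layer_conj_cons]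
    rw [List.pairwise_cons] at hd
    by_cases h : ∀ v, (qd i).On v → v ∉ T
    · rw [(hV i).conj_triv hG fun v hv => hW v (h v hv)]
      exact ih W T hd.2 hW u hu fun j hj => hl j (List.mem_cons_of_mem _ hj)
    · have hui : ¬ (qd i).On u := fun h' => h (hl i List.mem_cons_self h')
      refine ih _ (T ∪ {v | (qd i).On v}) hd.2 ?_ u ?_ ?_
      · intro v hv
        simp only [Set.mem_union, Set.mem_ofPred_eq, not_or] at hv
        exact (((hV i).triv hv.2).conjTranspose.mul (hW v hv.1)).mul ((hV i).triv hv.2)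
      · simp [hu, hui]
      · intro j hj hju v hv
        simp only [Set.mem_union, Set.mem_ofPred_eq, not_or]
        exact ⟨hl j (List.mem_cons_of_mem _ hj) hju v hv, fun h' => hd.1 j hj v h' hv⟩

theorem layer_null [Nonempty β] (hV : ∀ i, IsGate (qd i) G (op i))
    (hG : ∀ a a' c c', ∑ b, ∑ e, G a b c e * star (G a' b c' e) =
      if a = a' then (if c = c' then 1 else 0) else 0) (mv : ι → Prop) (D : Set S) (l : List ι) :
    ∀ (W : Matrix (S → β) (S → β) ℂ) (C : Set S),
      l.Pairwise (fun i j => ∀ u, (qd i).On u → ¬ (qd j).On u) → NullOn W C → C ⊆ D →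
      (∀ i ∈ l, mv i → (qd i).r1 ∈ D ∧ (qd i).r2 ∈ D ∧ TrivAt W (qd i).r1 ∧
        TrivAt W (qd i).r2) →
      (∀ i ∈ l, ¬ mv i → ∀ u, (qd i).On u → u ∉ D) →
      NullOn (((l.map op).prod)ᴴ * W * (l.map op).prod)
        {u | (u ∈ C ∧ ∀ i ∈ l, mv i → u ≠ (qd i).l1 ∧ u ≠ (qd i).l2) ∨
          ∃ i ∈ l, mv i ∧ (u = (qd i).r1 ∨ u = (qd i).r2)} := by
  induction l with
  | nil =>
    intro W C _ hW _ _ _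
    simpa using hW
  | cons i l ih =>
    intro W C hd hW hC hm hs
    rw [layer_conj_cons]
    rw [List.pairwise_cons] at hd
    have hm' : ∀ j ∈ l, mv j → (qd j).r1 ∈ D ∧ (qd j).r2 ∈ D ∧
        TrivAt ((op i)ᴴ * W * op i) (qd j).r1 ∧ TrivAt ((op i)ᴴ * W * op i) (qd j).r2 := by
      intro j hj hmj
      obtain ⟨h1, h2, h3, h4⟩ := hm j (List.mem_cons_of_mem _ hj) hmj
      have t1 := (hV i).triv fun h => hd.1 j hj _ h (qd j).on3
      have t2 := (hV i).triv fun h => hd.1 j hj _ h (qd j).on4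
      exact ⟨h1, h2, (t1.conjTranspose.mul h3).mul t1, (t2.conjTranspose.mul h4).mul t2⟩
    have hs' : ∀ j ∈ l, ¬ mv j → ∀ u, (qd j).On u → u ∉ D :=
      fun j hj => hs j (List.mem_cons_of_mem _ hj)
    by_cases h : mv i
    · obtain ⟨h1, h2, h3, h4⟩ := hm i List.mem_cons_self h
      have hN := (hV i).null_move hG h3 h4 hW
        (C' := {u | (u ∈ C ∧ u ≠ (qd i).l1 ∧ u ≠ (qd i).l2) ∨ u = (qd i).r1 ∨ u = (qd i).r2})
        (by simp) (by simp) (by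
          intro u hu
          simp only [Set.mem_ofPred_eq]
          tauto)
      refine (ih _ _ hd.2 hN ?_ hm' hs').mono ?_
      · rintro u (hu | rfl | rfl)
        · exact hC hu.1
        · exact h1
        · exact h2
      · rintro u (⟨hu1 | hu1, hu2⟩ | ⟨j, hj, hu⟩)
        · left
          refine ⟨hu1.1, fun j hj hmj => ?_⟩
          rcases List.mem_cons.1 hj with rfl | hj
          · exact hu1.2
          · exact hu2 j hj hmj
        · exact Or.inr ⟨i, List.mem_cons_self, h, hu1⟩
        · exact Or.inr ⟨j, List.mem_cons_of_mem _ hj, hu⟩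
    · have hN := (hV i).null_stay hW fun u hu hq => hs i List.mem_cons_self h u hq (hC hu)
      refine (ih _ _ hd.2 hN hC hm' hs').mono ?_
      rintro u (⟨hu1, hu2⟩ | ⟨j, hj, hu⟩)
      · left
        refine ⟨hu1, fun j hj hmj => ?_⟩
        rcases List.mem_cons.1 hj with rfl | hj
        · exact absurd hmj h
        · exact hu2 j hj hmj
      · exact Or.inr ⟨j, List.mem_cons_of_mem _ hj, hu⟩

end Layer

end TUHelpers

section TULattice

variable {d L : ℕ} [NeZero L]

theorem siteOpG_triv (a : Matrix (Fin d) (Fin d) ℂ) {x u : Site L} (h : u ≠ x) :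
    TrivAt (siteOpG a x) u := by
  refine ⟨fun f g hfg => ?_, fun f g c hfg => ?_⟩
  · simp only [siteOpG, of_apply]
    rw [if_neg, zero_mul]
    exact fun h' => hfg (h' u h)
  · simp only [siteOpG, of_apply, Function.update_of_ne (Ne.symm h)]
    congr 1
    refine if_congr ?_ rfl rfl
    refine forall_congr' fun v => ?_
    by_cases hv : v = u
    · subst hv; simp [hfg]
    · simp [Function.update_of_ne hv]

theorem siteOpG_null (b : Matrix (Fin d) (Fin d) ℂ) (hb : b.trace = 0) (y : Site L) :
    NullOn (siteOpG b y) {y} := by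
  intro X hX
  have hX := hX y rfl
  have h1 : (X * siteOpG b y).trace = ∑ f, X f f * b (f y) (f y) := by
    simp only [Matrix.trace, Matrix.diag, Matrix.mul_apply]
    refine Finset.sum_congr rfl fun f _ => ?_
    rw [Finset.sum_eq_single f]
    · simp [siteOpG]
    · intro g _ hg
      by_cases h : f y = g y
      · simp only [siteOpG, of_apply]
        rw [if_neg, zero_mul, mul_zero]
        intro h'
        apply hg
        funext u
        by_cases hu : u = y
        · rw [hu, h]
        · exact h' u hu
      · rw [hX.1 _ _ h, zero_mul]
    · simp
  rw [h1, ← Equiv.sum_comp (Equiv.funSplitAt y (Fin d)).symm, Fintype.sum_prod_type,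
    Finset.sum_comm]
  refine Finset.sum_eq_zero fun r _ => ?_
  have e1 : ∀ c, (Equiv.funSplitAt y (Fin d)).symm (c, r) y = c := fun c => by simp
  by_cases hne : Nonempty (Fin d)
  · obtain ⟨c0⟩ := hne
    have e2 : ∀ c, X ((Equiv.funSplitAt y (Fin d)).symm (c, r))
        ((Equiv.funSplitAt y (Fin d)).symm (c, r)) =
        X ((Equiv.funSplitAt y (Fin d)).symm (c0, r))
        ((Equiv.funSplitAt y (Fin d)).symm (c0, r)) := by
      intro c
      have h3 := hX.2 ((Equiv.funSplitAt y (Fin d)).symm (c0, r)) _ c rfl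
      have : Function.update ((Equiv.funSplitAt y (Fin d)).symm (c0, r)) y c =
          (Equiv.funSplitAt y (Fin d)).symm (c, r) := by
        funext u
        by_cases hu : u = y
        · subst hu; simp
        · simp [hu]
      rw [this] at h3
      exact h3
    simp only [e1, e2, ← Finset.mul_sum]
    have : ∑ c, b c c = 0 := hb
    rw [this, mul_zero]
  · exact Finset.sum_eq_zero fun c _ => absurd ⟨c⟩ hne

/-- Anchors of the plaquettes of a layer. -/
def ancs (L o : ℕ) : List (Site L) :=
  (List.range (L / 2)).flatMap fun i => (List.range (L / 2)).map fun j =>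
    (((2 * i + o : ℕ) : ZMod L), ((2 * j + o : ℕ) : ZMod L))

theorem Uee_eq (U : Matrix (FourIdx d) (FourIdx d) ℂ) :
    Uee d L U = ((ancs L 0).map (plaqOp U)).prod := by
  simp only [Uee, ancs, List.map_flatMap, List.map_map, Function.comp_def, add_zero]

theorem Uoo_eq (U : Matrix (FourIdx d) (FourIdx d) ℂ) :
    Uoo d L U = ((ancs L 1).map (plaqOp U)).prod := by
  simp only [Uoo, ancs, List.map_flatMap, List.map_map, Function.comp_def]

theorem ancs_mem {o : ℕ} {z : Site L} : z ∈ ancs L o ↔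
    ∃ i < L / 2, ∃ j < L / 2, (((2 * i + o : ℕ) : ZMod L), ((2 * j + o : ℕ) : ZMod L)) = z := by
  simp [ancs]

theorem ancs_nodup {o : ℕ} (ho : o ≤ 1) : (ancs L o).Nodup := by
  have inj : ∀ i < L / 2, ∀ j < L / 2,
      ((2 * i + o : ℕ) : ZMod L) = ((2 * j + o : ℕ) : ZMod L) → i = j := by
    intro i hi j hj h
    rw [ZMod.natCast_eq_natCast_iff', Nat.mod_eq_of_lt (by omega), Nat.mod_eq_of_lt (by omega)] at h
    omega
  have : ancs L o = ((List.range (L / 2)) ×ˢ (List.range (L / 2))).map fun p =>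
    (((2 * p.1 + o : ℕ) : ZMod L), ((2 * p.2 + o : ℕ) : ZMod L)) := by
    simp only [ancs, SProd.sprod, List.product, List.map_flatMap, List.map_map, Function.comp_def]
  rw [this]
  refine List.Nodup.map_on ?_ (List.nodup_range.product List.nodup_range)
  rintro ⟨i, j⟩ hp ⟨i', j'⟩ hp' h
  simp only [List.mem_product, List.mem_range, Prod.mk.injEq] at hp hp' h ⊢
  exact ⟨inj _ hp.1 _ hp'.1 h.1, inj _ hp.2 _ hp'.2 h.2⟩

theorem coord_cover (hL : Even L) {o : ℕ} (ho : o ≤ 1) (c : ZMod L) :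
    ∃ i < L / 2, c = ((2 * i + o : ℕ) : ZMod L) ∨ c = ((2 * i + o : ℕ) : ZMod L) + 1 := by
  have hlt := ZMod.val_lt c
  have hc : ((c.val : ℕ) : ZMod L) = c := ZMod.natCast_zmod_val c
  obtain ⟨m, hm⟩ := hL
  have hor : (∃ i < L / 2, c.val = 2 * i + o ∨ c.val = 2 * i + o + 1) ∨ (c.val = 0 ∧ o = 1) := by
    by_cases h : c.val = 0 ∧ o = 1
    · exact Or.inr h
    · exact Or.inl ⟨(c.val - o) / 2, by omega, by omega⟩
  rcases hor with ⟨i, hi, h | h⟩ | ⟨h, rfl⟩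
  · exact ⟨i, hi, Or.inl (by rw [← h, hc])⟩
  · exact ⟨i, hi, Or.inr (by rw [← hc, h]; push_cast; ring)⟩
  · refine ⟨L / 2 - 1, by omega, Or.inr ?_⟩
    rw [h] at hc
    have : 2 * (L / 2 - 1) + 1 + 1 = L := by have := NeZero.ne L; omega
    rw [← hc, ← Nat.cast_succ, Nat.succ_eq_add_one, this]
    simp

theorem ancs_cover (hL : Even L) {o : ℕ} (ho : o ≤ 1) (u : Site L) :
    ∃ z ∈ ancs L o, u = z ∨ u = z + (1, 0) ∨ u = z + (0, 1) ∨ u = z + (1, 1) := by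
  obtain ⟨i, hi, h1⟩ := coord_cover hL ho u.1
  obtain ⟨j, hj, h2⟩ := coord_cover hL ho u.2
  refine ⟨_, ancs_mem.2 ⟨i, hi, j, hj, rfl⟩, ?_⟩
  rcases h1 with h1 | h1 <;> rcases h2 with h2 | h2
  · left; exact Prod.ext h1 h2
  · right; right; left; exact Prod.ext (by simpa using h1) (by simpa using h2)
  · right; left; exact Prod.ext (by simpa using h1) (by simpa using h2)
  · right; right; right; exact Prod.ext (by simpa using h1) (by simpa using h2)

/-- Reduction mod 2. -/
def par (hL : Even L) : ZMod L →+* ZMod 2 := ZMod.castHom hL.two_dvd (ZMod 2)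

theorem ancs_par (hL : Even L) {o : ℕ} {z : Site L} (hz : z ∈ ancs L o) :
    par hL z.1 = o ∧ par hL z.2 = o := by
  obtain ⟨i, _, j, _, rfl⟩ := ancs_mem.1 hz
  have h2 : (2 : ZMod 2) = 0 := rfl
  simp only [map_natCast]
  push_cast
  simp [h2]

theorem par_odd (hL : Even L) (c : ZMod L) : par hL c = if Odd c.val then 1 else 0 := by
  have : par hL c = (c.val : ZMod 2) := by
    conv_lhs => rw [← ZMod.natCast_zmod_val c]
    rw [map_natCast]
  rw [this]
  split_ifs with h
  · exact (ZMod.natCast_eq_one_iff_odd).2 h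
  · rw [Nat.not_odd_iff_even] at h
    exact (ZMod.natCast_eq_zero_iff_even).2 h

theorem plaq_disj (hL : Even L) {z z' u : Site L} (h1 : par hL z.1 = par hL z'.1)
    (h2 : par hL z.2 = par hL z'.2)
    (hu : u = z ∨ u = z + (1, 0) ∨ u = z + (0, 1) ∨ u = z + (1, 1))
    (hus : u = z' ∨ u = z' + (1, 0) ∨ u = z' + (0, 1) ∨ u = z' + (1, 1)) : z = z' := by
  have aux : ∀ a b c : ZMod L, par hL a = par hL b → (c = a ∨ c = a + 1) → (c = b ∨ c = b + 1) →
      a = b := by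
    rintro a b c h (rfl | rfl) (h' | h')
    · exact h'
    · rw [h'] at h; simp at h
    · rw [← h'] at h; simp at h
    · exact add_right_cancel h'
  have s1 : ∀ w : Site L, (u = w ∨ u = w + (1, 0) ∨ u = w + (0, 1) ∨ u = w + (1, 1)) →
      (u.1 = w.1 ∨ u.1 = w.1 + 1) ∧ (u.2 = w.2 ∨ u.2 = w.2 + 1) := by
    rintro w (rfl | rfl | rfl | rfl) <;> simp
  exact Prod.ext (aux _ _ u.1 h1 (s1 z hu).1 (s1 z' hus).1)
    (aux _ _ u.2 h2 (s1 z hu).2 (s1 z' hus).2)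

/-- A choice of axis and direction of the plaquettes. -/
structure Orient (hL : Even L) (U : Matrix (FourIdx d) (FourIdx d) ℂ) where
  φ : Site L → ZMod L
  e : ℤ
  he : e = 1 ∨ e = -1
  κ : ZMod 2
  qd : Site L → Quad (Site L)
  G : (Fin d × Fin d) → (Fin d × Fin d) → (Fin d × Fin d) → (Fin d × Fin d) → ℂ
  hV : ∀ z, IsGate (qd z) G (plaqOp U z)
  hG1 : ∀ a b a' b', ∑ c, ∑ e, star (G c e a b) * G c e a' b' =
      if a = a' then (if b = b' then 1 else 0) else 0
  hG2 : ∀ a a' c c', ∑ b, ∑ e, G a b c e * star (G a' b c' e) =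
      if a = a' then (if c = c' then 1 else 0) else 0
  hon : ∀ z u, (qd z).On u ↔ (u = z ∨ u = z + (1, 0) ∨ u = z + (0, 1) ∨ u = z + (1, 1))
  hl2 : ∀ z, φ (qd z).l2 = φ (qd z).l1
  hr1 : ∀ z, φ (qd z).r1 = φ (qd z).l1 + e
  hr2 : ∀ z, φ (qd z).r2 = φ (qd z).l1 + e
  hφ : ∀ z o, par hL z.1 = o → par hL z.2 = o → par hL (φ (qd z).l1) = o + κ

variable {hL : Even L} {U : Matrix (FourIdx d) (FourIdx d) ℂ}

/-- The invariant after `s` layers. -/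
def Orient.Inv (O : Orient hL U) (y : Site L) (s : ℕ)
    (W : Matrix (GlobalIdx d L) (GlobalIdx d L) ℂ) : Prop :=
  NullOn W {u | O.φ u = O.φ y + ((O.e * s : ℤ) : ZMod L)} ∧
    ∀ u, u ∉ {u : Site L | ∃ k : ℤ, |k| ≤ s ∧ O.φ u = O.φ y + (k : ZMod L)} → TrivAt W u

theorem Orient.on_cases (O : Orient hL U) {z u : Site L} (h : (O.qd z).On u) :
    ((u = (O.qd z).l1 ∨ u = (O.qd z).l2) ∧ O.φ u = O.φ (O.qd z).l1) ∨
      ((u = (O.qd z).r1 ∨ u = (O.qd z).r2) ∧ O.φ u = O.φ (O.qd z).l1 + O.e) := by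
  rcases h with rfl | rfl | rfl | rfl
  · simp
  · simp [O.hl2]
  · simp [O.hr1]
  · simp [O.hr2]

theorem Orient.par_e (O : Orient hL U) : par hL (O.e : ZMod L) = 1 := by
  rcases O.he with h | h <;> rw [h] <;> simp

theorem Orient.step (O : Orient hL U) (hd : 1 ≤ d) {y : Site L} {s : ℕ} (hs : 2 * s + 2 ≤ L)
    {o : ℕ} (ho : o ≤ 1) (hpar : (o : ZMod 2) + O.κ = par hL (O.φ y) + s)
    {W : Matrix (GlobalIdx d L) (GlobalIdx d L) ℂ} (hW : O.Inv y s W) :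
    O.Inv y (s + 1)
      ((((ancs L o).map (plaqOp U)).prod)ᴴ * W * ((ancs L o).map (plaqOp U)).prod) := by
  have : Nonempty (Fin d) := ⟨⟨0, hd⟩⟩
  have hdis : (ancs L o).Pairwise (fun i j => ∀ u, (O.qd i).On u → ¬ (O.qd j).On u) := by
    refine List.Pairwise.imp_of_mem ?_ (ancs_nodup (L := L) ho)
    intro z z' hz hz' hne u hu hu'
    obtain ⟨p1, p2⟩ := ancs_par hL hz
    obtain ⟨p1', p2'⟩ := ancs_par hL hz'
    exact hne (plaq_disj hL (p1.trans p1'.symm) (p2.trans p2'.symm) ((O.hon _ _).1 hu)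
      ((O.hon _ _).1 hu'))
  have hlp : ∀ z ∈ ancs L o, par hL (O.φ (O.qd z).l1) = par hL (O.φ y) + s := by
    intro z hz
    obtain ⟨p1, p2⟩ := ancs_par hL hz
    rw [O.hφ z _ p1 p2, hpar]
  have hcs : par hL (O.φ y + ((O.e * s : ℤ) : ZMod L)) = par hL (O.φ y) + s := by
    push_cast
    rw [map_add, map_mul, O.par_e, map_natCast, one_mul]
  have hnext : O.φ y + ((O.e * (s + 1 : ℕ) : ℤ) : ZMod L) =
      O.φ y + ((O.e * s : ℤ) : ZMod L) + O.e := by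
    push_cast; ring
  have hne1 : ∀ p : ZMod 2, p + 1 ≠ p := by decide
  have hbad : ∀ z ∈ ancs L o, O.φ (O.qd z).l1 + O.e ≠ O.φ y + ((O.e * s : ℤ) : ZMod L) := by
    intro z hz h
    have := congrArg (par hL) h
    rw [map_add, hlp z hz, hcs, O.par_e] at this
    exact hne1 _ this
  have hbad' : ∀ z ∈ ancs L o, O.φ (O.qd z).l1 ≠ O.φ y + ((O.e * s : ℤ) : ZMod L) + O.e := by
    intro z hz h
    have := congrArg (par hL) h
    rw [map_add, hlp z hz, hcs, O.par_e] at this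
    exact hne1 _ this.symm
  have hout : ∀ u, O.φ u = O.φ y + ((O.e * s : ℤ) : ZMod L) + O.e → TrivAt W u := by
    intro u hu
    apply hW.2
    rintro ⟨k, hk, hk'⟩
    rw [hu, ← hnext] at hk'
    have h0 := add_left_cancel hk'
    rw [ZMod.intCast_eq_intCast_iff_dvd_sub] at h0
    have hk2 := abs_le.1 hk
    have hle := Int.eq_zero_of_abs_lt_dvd h0 (by
      rw [abs_lt]
      rcases O.he with h | h <;> rw [h] <;> push_cast <;> constructor <;> linarith)
    rcases O.he with h | h <;> rw [h] at hle <;> push_cast at hle <;> linarith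
  constructor
  · refine (layer_null O.hV O.hG2
      (fun z => O.φ (O.qd z).l1 = O.φ y + ((O.e * s : ℤ) : ZMod L))
      {u | O.φ u = O.φ y + ((O.e * s : ℤ) : ZMod L) ∨
        O.φ u = O.φ y + ((O.e * s : ℤ) : ZMod L) + O.e}
      (ancs L o) W _ hdis hW.1 (fun u hu => Or.inl hu) ?_ ?_).mono ?_
    · intro z hz hm
      have h1 := O.hr1 z
      have h2 := O.hr2 z
      rw [hm] at h1 h2
      exact ⟨Or.inr h1, Or.inr h2, hout _ h1, hout _ h2⟩
    · intro z hz hm u hu hD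
      rcases O.on_cases hu with ⟨_, h⟩ | ⟨_, h⟩ <;> rcases hD with hD | hD <;> rw [h] at hD
      · exact hm hD
      · exact hbad' z hz hD
      · exact hbad z hz hD
      · exact hm (add_right_cancel hD)
    · rintro u (⟨hu1, hu2⟩ | ⟨z, hz, hm, hu⟩)
      · exfalso
        obtain ⟨z, hz, hzu⟩ := ancs_cover hL ho u
        have hu1 : O.φ u = _ := hu1
        rcases O.on_cases ((O.hon _ _).2 hzu) with ⟨hl, h⟩ | ⟨hl, h⟩
        · have := hu2 z hz (by rw [← h, hu1])
          tauto
        · exact hbad z hz (by rw [← h, hu1])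
      · change O.φ u = _
        rw [hnext, ← hm]
        rcases hu with rfl | rfl
        · exact O.hr1 z
        · exact O.hr2 z
  · intro u hu
    refine layer_cone O.hV O.hG1 (ancs L o) W _ hdis hW.2 u ?_ ?_
    · rintro ⟨k, hk, hk'⟩
      exact hu ⟨k, by push_cast; linarith, hk'⟩
    · rintro z hz hzu v hzv ⟨k, hk, hk'⟩
      apply hu
      have hk2 := abs_le.1 hk
      have fin : ∀ m : ℤ, (m = 1 ∨ m = 0 ∨ m = -1) → O.φ u = O.φ v + (m : ZMod L) →
          u ∈ {u : Site L | ∃ k : ℤ, |k| ≤ (s + 1 : ℕ) ∧ O.φ u = O.φ y + (k : ZMod L)} := by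
        intro m hm h
        refine ⟨k + m, ?_, by rw [h, hk']; push_cast; ring⟩
        rw [abs_le]
        push_cast
        rcases hm with rfl | rfl | rfl <;> constructor <;> linarith
      have he := O.he
      rcases O.on_cases hzu with ⟨_, h⟩ | ⟨_, h⟩ <;> rcases O.on_cases hzv with ⟨_, h'⟩ | ⟨_, h'⟩
      · exact fin 0 (by simp) (by rw [h, h']; simp)
      · exact fin (-O.e) (by omega) (by rw [h, h']; simp)
      · exact fin O.e (by omega) (by rw [h, h'])
      · exact fin 0 (by simp) (by rw [h, h']; simp)

theorem Orient.main (O : Orient hL U) (hd : 1 ≤ d) {x y : Site L} {t : ℕ} (hLt : 4 * t ≤ L)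
    (hy : par hL (O.φ y) = 1 + O.κ) (hx : O.φ x ≠ O.φ y + ((O.e * (2 * t : ℕ) : ℤ) : ZMod L))
    (a b : Matrix (Fin d) (Fin d) ℂ) (hb : b.trace = 0) :
    (siteOpG a x * (Ustep d L U)ᴴ ^ t * siteOpG b y * (Ustep d L U) ^ t).trace = 0 := by
  have h2 : (2 : ZMod 2) = 0 := rfl
  have key : ∀ k, 4 * k ≤ L →
      O.Inv y (2 * k) ((Ustep d L U)ᴴ ^ k * siteOpG b y * (Ustep d L U) ^ k) := by
    intro k
    induction k with
    | zero =>
      intro _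
      refine ⟨?_, fun u hu => ?_⟩
      · simp only [pow_zero, one_mul, mul_one]
        refine (siteOpG_null b hb y).mono ?_
        rintro u rfl
        simp
      · simp only [pow_zero, one_mul, mul_one]
        apply siteOpG_triv
        rintro rfl
        exact hu ⟨0, by simp, by simp⟩
    | succ k ih =>
      intro hk
      have i1 := O.step hd (s := 2 * k) (by omega) (o := 1) le_rfl
        (by rw [hy]; push_cast; rw [h2]; ring) (ih (by omega))
      have i2 := O.step hd (s := 2 * k + 1) (by omega) (o := 0) (by omega)
        (by rw [hy]; push_cast; rw [h2]; linear_combination -h2) i1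
      rw [← Uoo_eq, ← Uee_eq] at i2
      have : (Ustep d L U)ᴴ ^ (k + 1) * siteOpG b y * (Ustep d L U) ^ (k + 1) =
          (Uee d L U)ᴴ * ((Uoo d L U)ᴴ * ((Ustep d L U)ᴴ ^ k * siteOpG b y * (Ustep d L U) ^ k) *
            Uoo d L U) * Uee d L U := by
        rw [pow_succ', pow_succ]
        simp only [Ustep, conjTranspose_mul, Matrix.mul_assoc]
      rw [this]
      exact i2
  have := (key t hLt).1 (siteOpG a x) (by
    intro u hu
    apply siteOpG_triv
    rintro rfl
    exact hx hu)
  simpa only [Matrix.mul_assoc] using this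

theorem zmod_one_ne (hL2 : 2 ≤ L) : (1 : ZMod L) ≠ 0 := by
  have : Fact (1 < L) := ⟨hL2⟩
  exact one_ne_zero

/-- Legs split along the first axis. -/
def quad1 (hL2 : 2 ≤ L) (z : Site L) : Quad (Site L) where
  l1 := z
  l2 := z + (0, 1)
  r1 := z + (1, 0)
  r2 := z + (1, 1)
  h12 := by simp [Prod.ext_iff, zmod_one_ne hL2]
  h13 := by simp [Prod.ext_iff, zmod_one_ne hL2]
  h14 := by simp [Prod.ext_iff, zmod_one_ne hL2]
  h23 := by simp [Prod.ext_iff, zmod_one_ne hL2]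
  h24 := by simp [Prod.ext_iff, (zmod_one_ne hL2).symm]
  h34 := by simp [Prod.ext_iff, (zmod_one_ne hL2).symm]

/-- Legs split along the second axis. -/
def quad2 (hL2 : 2 ≤ L) (z : Site L) : Quad (Site L) where
  l1 := z
  l2 := z + (1, 0)
  r1 := z + (0, 1)
  r2 := z + (1, 1)
  h12 := by simp [Prod.ext_iff, zmod_one_ne hL2]
  h13 := by simp [Prod.ext_iff, zmod_one_ne hL2]
  h14 := by simp [Prod.ext_iff, zmod_one_ne hL2]
  h23 := by simp [Prod.ext_iff, zmod_one_ne hL2]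
  h24 := by simp [Prod.ext_iff, (zmod_one_ne hL2).symm]
  h34 := by simp [Prod.ext_iff, (zmod_one_ne hL2).symm]

/-- Exchange of left and right legs. -/
def Quad.swap {S : Type} (q : Quad S) : Quad S where
  l1 := q.r1
  l2 := q.r2
  r1 := q.l1
  r2 := q.l2
  h12 := q.h34
  h13 := q.h13.symm
  h14 := q.h23.symm
  h23 := q.h14.symm
  h24 := q.h24.symm
  h34 := q.h12

theorem Quad.swap_on {S : Type} (q : Quad S) (u : S) : q.swap.On u ↔ q.On u := by
  simp only [Quad.On, Quad.swap]
  tauto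

theorem quad1_on (hL2 : 2 ≤ L) (z u : Site L) : (quad1 hL2 z).On u ↔
    (u = z ∨ u = z + (1, 0) ∨ u = z + (0, 1) ∨ u = z + (1, 1)) := by
  simp only [Quad.On, quad1]
  tauto

theorem quad2_on (hL2 : 2 ≤ L) (z u : Site L) : (quad2 hL2 z).On u ↔
    (u = z ∨ u = z + (1, 0) ∨ u = z + (0, 1) ∨ u = z + (1, 1)) := by
  simp only [Quad.On, quad2]

theorem isGate_of (U : Matrix (FourIdx d) (FourIdx d) ℂ) {z : Site L} {q : Quad (Site L)}
    (hq : ∀ u, q.On u ↔ (u = z ∨ u = z + (1, 0) ∨ u = z + (0, 1) ∨ u = z + (1, 1)))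
    {G : (Fin d × Fin d) → (Fin d × Fin d) → (Fin d × Fin d) → (Fin d × Fin d) → ℂ}
    (hG : ∀ f g : GlobalIdx d L, U (f z, f (z + (1, 0)), f (z + (0, 1)), f (z + (1, 1)))
        (g z, g (z + (1, 0)), g (z + (0, 1)), g (z + (1, 1))) =
      G (f q.l1, f q.l2) (f q.r1, f q.r2) (g q.l1, g q.l2) (g q.r1, g q.r2)) :
    IsGate q G (plaqOp U z) := by
  have e : ∀ f g : GlobalIdx d L, (∀ u : Site L, u ≠ z → u ≠ z + (1, 0) → u ≠ z + (0, 1) →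
      u ≠ z + (1, 1) → f u = g u) ↔ (∀ u, ¬ q.On u → f u = g u) := by
    intro f g
    refine forall_congr' fun u => ?_
    rw [hq]
    tauto
  refine ⟨fun f g h => ?_, fun f g h => ?_⟩
  · rw [← e] at h
    simp only [plaqOp, of_apply]
    rw [if_pos h, hG]
  · rw [← e] at h
    simp only [plaqOp, of_apply]
    rw [if_neg h]

theorem IsGate.swap {S β : Type} [Fintype S] [DecidableEq S] {q : Quad S}
    {G : (β × β) → (β × β) → (β × β) → (β × β) → ℂ} {V : Matrix (S → β) (S → β) ℂ}
    (h : IsGate q G V) : IsGate q.swap (fun a b c e => G b a e c) V := by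
  refine ⟨fun f g hfg => ?_, fun f g hfg => ?_⟩
  · simp only [Quad.swap_on] at hfg
    exact h.1 f g hfg
  · simp only [Quad.swap_on] at hfg
    exact h.2 f g hfg

/-- Reversal of an orientation. -/
def Orient.rev (O : Orient hL U)
    (hG3 : ∀ a a' c c', ∑ b, ∑ e, O.G b a e c * star (O.G b a' e c') =
      if a = a' then (if c = c' then 1 else 0) else 0) : Orient hL U where
  φ := O.φ
  e := -O.e
  he := by have := O.he; omega
  κ := O.κ + 1
  qd z := (O.qd z).swap
  G a b c e := O.G b a e c
  hV z := (O.hV z).swap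
  hG1 a b a' b' := by
    rw [Finset.sum_comm, O.hG1]
    split_ifs <;> rfl
  hG2 := hG3
  hon z u := by rw [Quad.swap_on, O.hon]
  hl2 z := by simp only [Quad.swap, O.hr1, O.hr2]
  hr1 z := by simp [Quad.swap, O.hr1]
  hr2 z := by simp [Quad.swap, O.hr1, O.hl2]
  hφ z o h1 h2 := by
    simp only [Quad.swap, O.hr1]
    rw [map_add, O.hφ z o h1 h2, O.par_e, add_assoc]

theorem unit_left {M : Matrix (FourIdx d) (FourIdx d) ℂ} (h : Mᴴ * M = 1) (c c' : FourIdx d) :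
    ∑ r, star (M r c) * M r c' = if c = c' then 1 else 0 := by
  have := congrFun (congrFun h c) c'
  rwa [Matrix.mul_apply, Matrix.one_apply] at this

theorem unit_right {M : Matrix (FourIdx d) (FourIdx d) ℂ} (h : M * Mᴴ = 1) (c c' : FourIdx d) :
    ∑ r, M c r * star (M c' r) = if c = c' then 1 else 0 := by
  have := congrFun (congrFun h c) c'
  rwa [Matrix.mul_apply, Matrix.one_apply] at this

theorem eq_comm_ite {α : Type} [DecidableEq α] (p q : α) :
    (if p = q then (1 : ℂ) else 0) = if q = p then 1 else 0 :=
  if_congr eq_comm rfl rfl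

theorem four_ite (a a' c c' : Fin d × Fin d) :
    (if ((a.1, a.2, c.1, c.2) : FourIdx d) = (a'.1, a'.2, c'.1, c'.2) then (1 : ℂ) else 0) =
      if a = a' then (if c = c' then 1 else 0) else 0 := by
  obtain ⟨a1, a2⟩ := a
  obtain ⟨a1', a2'⟩ := a'
  obtain ⟨c1, c2⟩ := c
  obtain ⟨c1', c2'⟩ := c'
  simp only [Prod.mk.injEq, ← ite_and, and_assoc]

theorem four_ite_mid (a a' c c' : Fin d × Fin d) :
    (if ((a.1, c.1, a.2, c.2) : FourIdx d) = (a'.1, c'.1, a'.2, c'.2) then (1 : ℂ) else 0) =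
      if a = a' then (if c = c' then 1 else 0) else 0 := by
  obtain ⟨a1, a2⟩ := a
  obtain ⟨a1', a2'⟩ := a'
  obtain ⟨c1, c2⟩ := c
  obtain ⟨c1', c2'⟩ := c'
  simp only [Prod.mk.injEq, ← ite_and]
  exact if_congr (by tauto) rfl rfl

/-- Positive orientation along the first axis. -/
def orient1 (hL : Even L) (hL2 : 2 ≤ L) (hU : TernaryUnitary U) : Orient hL U where
  φ := Prod.fst
  e := 1
  he := Or.inl rfl
  κ := 0
  qd := quad1 hL2
  G a b c e := U (a.1, b.1, a.2, b.2) (c.1, e.1, c.2, e.2)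
  hV z := isGate_of U (quad1_on hL2 z) fun f g => rfl
  hG1 a b a' b' := by
    have := unit_left hU.1.2 (a.1, b.1, a.2, b.2) (a'.1, b'.1, a'.2, b'.2)
    simp only [Fintype.sum_prod_type] at this ⊢
    rw [four_ite_mid] at this
    rw [← this]
    refine Finset.sum_congr rfl fun c1 _ => ?_
    rw [Finset.sum_comm]
  hG2 a a' c c' := by
    have := unit_left hU.2.1.2 (a'.1, a'.2, c'.1, c'.2) (a.1, a.2, c.1, c.2)
    simp only [Fintype.sum_prod_type, reshuffle1, of_apply] at this ⊢
    rw [← four_ite, eq_comm_ite, ← this]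
    simp only [mul_comm]
  hon := quad1_on hL2
  hl2 z := by simp [quad1]
  hr1 z := by simp [quad1]
  hr2 z := by simp [quad1]
  hφ z o h1 h2 := by simpa [quad1] using h1

/-- Positive orientation along the second axis. -/
def orient2 (hL : Even L) (hL2 : 2 ≤ L) (hU : TernaryUnitary U) : Orient hL U where
  φ := Prod.snd
  e := 1
  he := Or.inl rfl
  κ := 0
  qd := quad2 hL2
  G a b c e := U (a.1, a.2, b.1, b.2) (c.1, c.2, e.1, e.2)
  hV z := isGate_of U (quad2_on hL2 z) fun f g => rfl
  hG1 a b a' b' := by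
    have := unit_left hU.1.2 (a.1, a.2, b.1, b.2) (a'.1, a'.2, b'.1, b'.2)
    simp only [Fintype.sum_prod_type] at this ⊢
    rw [four_ite] at this
    exact this
  hG2 a a' c c' := by
    have := unit_left hU.2.2.2 (a'.1, a'.2, c'.1, c'.2) (a.1, a.2, c.1, c.2)
    simp only [Fintype.sum_prod_type, reshuffle2, of_apply] at this ⊢
    rw [← four_ite, eq_comm_ite, ← this]
    simp only [mul_comm]
  hon := quad2_on hL2
  hl2 z := by simp [quad2]
  hr1 z := by simp [quad2]
  hr2 z := by simp [quad2]
  hφ z o h1 h2 := by simpa [quad2] using h2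

/-- Negative orientation along the first axis. -/
def orient1' (hL : Even L) (hL2 : 2 ≤ L) (hU : TernaryUnitary U) : Orient hL U :=
  (orient1 hL hL2 hU).rev (by
    intro a a' c c'
    have := unit_right hU.2.1.1 (a.1, a.2, c.1, c.2) (a'.1, a'.2, c'.1, c'.2)
    simp only [Fintype.sum_prod_type, reshuffle1, of_apply, orient1] at this ⊢
    rw [four_ite] at this
    exact this)

/-- Negative orientation along the second axis. -/
def orient2' (hL : Even L) (hL2 : 2 ≤ L) (hU : TernaryUnitary U) : Orient hL U :=
  (orient2 hL hL2 hU).rev (by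
    intro a a' c c'
    have := unit_right hU.2.2.1 (a.1, a.2, c.1, c.2) (a'.1, a'.2, c'.1, c'.2)
    simp only [Fintype.sum_prod_type, reshuffle2, of_apply, orient2] at this ⊢
    rw [four_ite] at this
    exact this)

end TULattice

/-- For a ternary unitary gate, the dynamic correlation of traceless local operators
vanishes unless `x` and `y` are connected along a light ray. -/
theorem dynamic_correlation_vanishes_off_lightray (d L t : ℕ) [NeZero L]
    (hd : 1 ≤ d) (hL : Even L) (hL2 : 2 ≤ L) (ht : 1 ≤ t) (hLt : 4 * t ≤ L)
    (U : Matrix (FourIdx d) (FourIdx d) ℂ) (hU : TernaryUnitary U)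
    (x y : Site L) (hxy : ¬ LightRay x y t) :
    ∀ a b : Matrix (Fin d) (Fin d) ℂ, a.trace = 0 → b.trace = 0 →
      (1 / (d : ℂ) ^ (L ^ 2)) *
        (siteOpG a x * (Ustep d L U)ᴴ ^ t * siteOpG b y * (Ustep d L U) ^ t).trace = 0 := by
  intro a b _ hb
  apply mul_eq_zero_of_right
  have p1 := par_odd hL y.1
  have p2 := par_odd hL y.2
  have h11 : (0 : ZMod 2) = 1 + (0 + 1) := by decide
  by_cases h1 : (if Odd y.1.val then x.1 = y.1 + ((2 * t : ℕ) : ZMod L)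
    else x.1 = y.1 - ((2 * t : ℕ) : ZMod L))
  · have h2 : ¬ (if Odd y.2.val then x.2 = y.2 + ((2 * t : ℕ) : ZMod L)
      else x.2 = y.2 - ((2 * t : ℕ) : ZMod L)) := fun h => hxy ⟨h1, h⟩
    split_ifs at h2 p2 with ho
    · refine (orient2 hL hL2 hU).main hd hLt ?_ ?_ a b hb
      · simpa [orient2] using p2
      · simpa [orient2] using h2
    · refine (orient2' hL hL2 hU).main hd hLt ?_ ?_ a b hb
      · exact p2.trans h11
      · simpa [orient2', orient2, Orient.rev, sub_eq_add_neg] using h2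
  · split_ifs at h1 p1 with ho
    · refine (orient1 hL hL2 hU).main hd hLt ?_ ?_ a b hb
      · simpa [orient1] using p1
      · simpa [orient1] using h1
    · refine (orient1' hL hL2 hU).main hd hLt ?_ ?_ a b hb
      · exact p1.trans h11
      · simpa [orient1', orient1, Orient.rev, sub_eq_add_neg] using h1
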